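/- The set B = A ∪ {γ_i : i = 1,…,⌊n/2⌋}, where A = {τ} ∪ {α_i : i = 1,…,⌊(n−1)/2⌋} ∪ {β_{j,i} : j = 1,…,⌊(n−3)/3⌋, i = 1,…,⌊(n−3j−1)/2⌋}, generates the monoid wEnd P_n. -/

import Mathlib

/-- `α` is a weak endomorphism of the path `P_n` (with vertices `0,…,n-1` standing for
`1,…,n`): `|iα - (i+1)α| ≤ 1` for all consecutive pairs of vertices. -/
def IsWEndo {n : ℕ} (f : Function.End (Fin n)) : Prop :=
  ∀ i : ℕ, ∀ h : i + 1 < n,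
    |(((f ⟨i, by omega⟩ : Fin n) : ℕ) : ℤ) - (((f ⟨i + 1, h⟩ : Fin n) : ℕ) : ℤ)| ≤ 1

/-- `α` is an endomorphism of the path `P_n`: `|iα - (i+1)α| = 1` for all consecutive
pairs of vertices. -/
def IsEndo {n : ℕ} (f : Function.End (Fin n)) : Prop :=
  ∀ i : ℕ, ∀ h : i + 1 < n,
    |(((f ⟨i, by omega⟩ : Fin n) : ℕ) : ℤ) - (((f ⟨i + 1, h⟩ : Fin n) : ℕ) : ℤ)| = 1

/-- The reversal map `τ` of `{1,…,n}`, `xτ = n - x + 1` (in `0`-indexed form: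
`x ↦ n - 1 - x`). -/
def pathTau (n : ℕ) : Function.End (Fin n) :=
  fun x => ⟨(n - 1 - (x : ℕ)) % n, Nat.mod_lt _ x.pos⟩

/-- The transformation `α_i` of `{1,…,n}`: `xα_i = i + 2 - x` for `1 ≤ x ≤ i+1` and
`xα_i = x - i` for `i+1 ≤ x ≤ n`.  In `0`-indexed form this is `x ↦ |x - i|`
(the `% n` is the identity in the considered range `1 ≤ i ≤ n-2`). -/
def pathAlpha (n i : ℕ) : Function.End (Fin n) :=
  fun x => ⟨(if (x : ℕ) ≤ i then i - (x : ℕ) else (x : ℕ) - i) % n, Nat.mod_lt _ x.pos⟩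

/-- The transformation `β_{j,i}` of `{1,…,n}`: `xβ = x` for `1 ≤ x ≤ i+j+1`,
`xβ = 2(i+j+1) - x` for `i+j+1 ≤ x ≤ i+2j+1`, and `xβ = x - 2j` for `i+2j+1 ≤ x ≤ n`.
(`0`-indexed below; the `% n` is the identity in the considered ranges of `i,j`.) -/
def pathBeta (n j i : ℕ) : Function.End (Fin n) :=
  fun x => ⟨(if (x : ℕ) ≤ i + j then (x : ℕ)
      else if (x : ℕ) ≤ i + 2 * j then 2 * (i + j) - (x : ℕ)
      else (x : ℕ) - 2 * j) % n, Nat.mod_lt _ x.pos⟩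

/-- The transformation `γ_i` of `{1,…,n}`: `xγ_i = x` for `1 ≤ x ≤ i` and `xγ_i = x - 1`
for `i+1 ≤ x ≤ n` (`0`-indexed below; the `% n` is the identity). -/
def pathGamma (n i : ℕ) : Function.End (Fin n) :=
  fun x => ⟨(if (x : ℕ) < i then (x : ℕ) else (x : ℕ) - 1) % n, Nat.mod_lt _ x.pos⟩

/-- The set `A = {τ} ∪ {α_i : 1 ≤ i ≤ ⌊(n-1)/2⌋} ∪
{β_{j,i} : 1 ≤ j ≤ ⌊(n-3)/3⌋, 1 ≤ i ≤ ⌊(n-3j-1)/2⌋}`. -/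
def genA (n : ℕ) : Set (Function.End (Fin n)) :=
  {pathTau n} ∪ {g | ∃ i, 1 ≤ i ∧ i ≤ (n - 1) / 2 ∧ g = pathAlpha n i}
    ∪ {g | ∃ j, 1 ≤ j ∧ j ≤ (n - 3) / 3 ∧
        ∃ i, 1 ≤ i ∧ i ≤ (n - 3 * j - 1) / 2 ∧ g = pathBeta n j i}

/-- The set `B = A ∪ {γ_i : 1 ≤ i ≤ ⌊n/2⌋}`. -/
def genB (n : ℕ) : Set (Function.End (Fin n)) :=
  genA n ∪ {g | ∃ i, 1 ≤ i ∧ i ≤ n / 2 ∧ g = pathGamma n i}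

/-- The map `w`, restricted to `{0,…,L}`, agrees with some element of the monoid generated
by `genB n`. -/
def IsGenerated (n L : ℕ) (w : ℕ → ℕ) : Prop :=
  ∃ h ∈ Submonoid.closure (genB n), ∀ x : Fin n, (x : ℕ) ≤ L → ((h x : Fin n) : ℕ) = w x

lemma IsGenerated.comp {n L M : ℕ} {g u w : ℕ → ℕ} (hu : IsGenerated n M u)
    (hg : IsGenerated n L g) (hgM : ∀ x ≤ L, g x ≤ M) (hw : ∀ x ≤ L, w x = u (g x)) :
    IsGenerated n L w := by
  obtain ⟨a, ha, hau⟩ := hu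
  obtain ⟨b, hb, hbg⟩ := hg
  refine ⟨a * b, mul_mem ha hb, fun x hx => ?_⟩
  have h := hbg x hx
  rw [hw x hx, ← h]
  exact hau (b x) (h ▸ hgM x hx)

lemma isGenerated_of_mem {n L : ℕ} {w : ℕ → ℕ} {g : Function.End (Fin n)} (hg : g ∈ genB n)
    (h : ∀ x : Fin n, (x : ℕ) ≤ L → ((g x : Fin n) : ℕ) = w x) : IsGenerated n L w :=
  ⟨g, Submonoid.subset_closure hg, h⟩

lemma isGenerated_id (n L : ℕ) : IsGenerated n L (fun x => x) :=
  ⟨1, one_mem _, fun _ _ => rfl⟩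

lemma pathTau_val {n : ℕ} (x : Fin n) : ((pathTau n x : Fin n) : ℕ) = n - 1 - x :=
  Nat.mod_eq_of_lt (by omega)

lemma pathAlpha_val {n i : ℕ} (hi : i < n) (x : Fin n) :
    ((pathAlpha n i x : Fin n) : ℕ) = (x - i) + (i - x) := by
  refine (Nat.mod_eq_of_lt ?_).trans ?_ <;> split_ifs <;> omega

lemma pathBeta_val {n j i : ℕ} (x : Fin n) :
    ((pathBeta n j i x : Fin n) : ℕ) = if (x : ℕ) ≤ i + j then (x : ℕ)
      else if (x : ℕ) ≤ i + 2 * j then 2 * (i + j) - (x : ℕ) else (x : ℕ) - 2 * j := by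
  refine Nat.mod_eq_of_lt ?_
  split_ifs <;> omega

lemma pathGamma_val {n i : ℕ} (x : Fin n) :
    ((pathGamma n i x : Fin n) : ℕ) = if (x : ℕ) < i then (x : ℕ) else (x : ℕ) - 1 := by
  refine Nat.mod_eq_of_lt ?_
  split_ifs <;> omega

lemma isGenerated_reverse (n L : ℕ) : IsGenerated n L (fun x => n - 1 - x) :=
  isGenerated_of_mem (Or.inl (Or.inl (Or.inl rfl))) fun x _ => pathTau_val x

lemma isGenerated_dist {n L a : ℕ} (ha : a < n) (hL : L < n) :
    IsGenerated n L (fun x => (x - a) + (a - x)) := by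
  have small : ∀ b M, b ≤ (n - 1) / 2 → IsGenerated n M (fun x => (x - b) + (b - x)) := by
    intro b M hb
    rcases Nat.eq_zero_or_pos b with rfl | hb0
    · simpa using isGenerated_id n M
    · exact isGenerated_of_mem (Or.inl (Or.inl (Or.inr ⟨b, hb0, hb, rfl⟩)))
        fun x _ => pathAlpha_val (by omega) x
  by_cases h : a ≤ (n - 1) / 2
  · exact small a L h
  · exact (small (n - 1 - a) (n - 1) (by omega)).comp (isGenerated_reverse n L)
      (fun x _ => by omega) (fun x hx => by omega)

lemma isGenerated_sub_left {n L a : ℕ} (ha : a < n) (hL : L ≤ a) :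
    IsGenerated n L (fun x => a - x) :=
  (isGenerated_id n a).comp (isGenerated_dist (L := L) ha (by omega))
    (fun x hx => by omega) (fun x hx => by omega)

lemma isGenerated_add_left {n L a : ℕ} (ha : a + L < n) :
    IsGenerated n L (fun x => a + x) :=
  (isGenerated_sub_left (L := L) (a := a + L) ha (by omega)).comp
    (isGenerated_sub_left (L := L) (a := L) (by omega) le_rfl)
    (fun x hx => by omega) (fun x hx => by omega)

/-- The zigzag map that goes up by `p`, down by `j` and then up again. -/
lemma isGenerated_zigzag {n L p j : ℕ} (hj : 1 ≤ j) (hjp : j ≤ p) (hp : p + 2 * j < n)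
    (hL : L < n) :
    IsGenerated n L
      (fun x => if x ≤ p then x else if x ≤ p + j then 2 * p - x else x - 2 * j) := by
  have small : ∀ q M, j ≤ q → 2 * (q - j) ≤ n - 3 * j - 1 → 3 * j < n → M < n →
      IsGenerated n M
        (fun x => if x ≤ q then x else if x ≤ q + j then 2 * q - x else x - 2 * j) := by
    intro q M hjq hq h3 hM
    rcases hjq.eq_or_lt with rfl | hlt
    · exact (isGenerated_dist (a := j) (L := n - 1) (by omega) (by omega)).comp
        (isGenerated_dist (a := j) (by omega) hM) (fun x hx => by omega)
        (fun x hx => by split_ifs <;> omega)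
    · refine isGenerated_of_mem (Or.inl (Or.inr ⟨j, hj, by omega, q - j, by omega, by omega, rfl⟩))
        fun x hx => ?_
      rw [pathBeta_val]
      split_ifs <;> omega
  by_cases h : 2 * (p - j) ≤ n - 3 * j - 1
  · exact small p L hjp h (by omega) hL
  · have h1 := (small (n - 1 - p - j) (n - 1) (by omega) (by omega) (by omega) (by omega)).comp
      (isGenerated_reverse n L) (fun x hx => by omega) (fun x hx => rfl)
    exact (isGenerated_sub_left (a := n - 1 - 2 * j) (by omega) le_rfl).comp h1
      (fun x hx => by split_ifs <;> omega)
      (fun x hx => by split_ifs <;> omega)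

lemma isGenerated_merge {n L i : ℕ} (hi : 1 ≤ i) (hin : i < n) (hL : L < n) :
    IsGenerated n L (fun x => if x < i then x else x - 1) := by
  have small : ∀ b M, 1 ≤ b → b ≤ n / 2 → IsGenerated n M (fun x => if x < b then x else x - 1) :=
    fun b M hb0 hb => isGenerated_of_mem (Or.inr ⟨b, hb0, hb, rfl⟩) fun x _ => pathGamma_val x
  by_cases h : i ≤ n / 2
  · exact small i L hi h
  · have h1 := (small (n - i) (n - 1) (by omega) (by omega)).comp
      (isGenerated_reverse n L) (fun x hx => by omega) (fun x hx => rfl)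
    exact (isGenerated_sub_left (a := n - 2) (by omega) le_rfl).comp h1
      (fun x hx => by split_ifs <;> omega)
      (fun x hx => by split_ifs <;> omega)

/-- A walk with unit steps is symmetric around a turning point `t`, up to the distance `j`
to the nearest other turning point. -/
lemma eq_reflect_of_turn {w : ℕ → ℕ} {L t j : ℕ}
    (hw : ∀ i < L, w (i + 1) = w i + 1 ∨ w i = w (i + 1) + 1)
    (ht : w (t - 1) = w (t + 1)) (hjt : j ≤ t) (htL : t + j ≤ L)
    (hturn : ∀ s, 0 < s → s < L → w (s - 1) = w (s + 1) → s ≠ t → j ≤ (s - t) + (t - s)) :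
    ∀ x ≤ j, w (t + x) = w (t - x) := by
  have key : ∀ x < j, w (t + x) = w (t - x) ∧ w (t + x + 1) = w (t - x - 1) := by
    intro x
    induction x with
    | zero => exact fun _ => ⟨rfl, ht.symm⟩
    | succ x ih =>
      intro hx
      obtain ⟨h0, h1⟩ := ih (by omega)
      obtain ⟨y, hy⟩ : ∃ y, t = y + x + 2 := ⟨t - x - 2, by omega⟩
      subst hy
      have e0 : y + x + 2 - x = y + 2 := by omega
      have e1 : y + x + 2 - (x + 1) = y + 1 := by omega
      have e2 : y + x + 2 + (x + 1) = y + x + 2 + x + 1 := by omega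
      have e3 : y + 2 - 1 = y + 1 := by omega
      rw [e0] at h0
      rw [e0, e3] at h1
      rw [e1, e2, Nat.add_sub_cancel]
      have s1 := hw y (by omega)
      have s2 := hw (y + 1) (by omega)
      have s3 := hw (y + x + 2 + x) (by omega)
      have s4 := hw (y + x + 2 + x + 1) (by omega)
      have a1 : w (y + x + 2 + x) ≠ w (y + x + 2 + x + 1 + 1) := fun h => by
        have := hturn (y + x + 2 + x + 1) (by omega) (by omega) h (by omega)
        omega
      have a2 : w y ≠ w (y + 1 + 1) := fun h => by
        have := hturn (y + 1) (by omega) (by omega) h (by omega)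
        omega
      rw [show y + 2 = y + 1 + 1 by omega] at h0
      omega
  intro x hx
  rcases x with _ | x
  · rfl
  · exact (key x (by omega)).2

lemma isGenerated_of_no_turn {n L : ℕ} {w : ℕ → ℕ}
    (hw : ∀ i < L, w (i + 1) = w i + 1 ∨ w i = w (i + 1) + 1) (hL : L < n)
    (hwn : ∀ i ≤ L, w i < n)
    (hturn : ∀ s, 0 < s → s < L → w (s - 1) ≠ w (s + 1)) : IsGenerated n L w := by
  rcases Nat.eq_zero_or_pos L with rfl | hL0
  · exact (isGenerated_add_left (a := w 0) (L := 0) (hwn 0 le_rfl)).comp (isGenerated_id n 0)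
      (fun x hx => hx) (fun x hx => by simp [Nat.le_zero.1 hx])
  · rcases hw 0 hL0 with h | h
    · have key : ∀ x < L, w x = w 0 + x ∧ w (x + 1) = w 0 + x + 1 := by
        intro x
        induction x with
        | zero => exact fun _ => ⟨rfl, h⟩
        | succ x ih =>
          intro hx
          have := ih (by omega)
          have := hw (x + 1) hx
          have : w x ≠ w (x + 1 + 1) := hturn (x + 1) (by omega) hx
          omega
      have key' : ∀ x ≤ L, w x = w 0 + x := by
        rintro (_ | x) hx
        · rfl
        · exact (key x hx).2
      have := hwn L le_rfl
      exact (isGenerated_add_left (a := w 0) (by rw [← key' L le_rfl]; exact this)).comp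
        (isGenerated_id n L) (fun x hx => hx) key'
    · have key : ∀ x < L, w x + x = w 0 ∧ w (x + 1) + x + 1 = w 0 := by
        intro x
        induction x with
        | zero => exact fun _ => ⟨rfl, h.symm⟩
        | succ x ih =>
          intro hx
          have := ih (by omega)
          have := hw (x + 1) hx
          have : w x ≠ w (x + 1 + 1) := hturn (x + 1) (by omega) hx
          omega
      have key' : ∀ x ≤ L, w x + x = w 0 := by
        rintro (_ | x) hx
        · rfl
        · exact (key x hx).2
      have := key' L le_rfl
      exact (isGenerated_sub_left (a := w 0) (hwn 0 (by omega)) (by omega)).comp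
        (isGenerated_id n L) (fun x hx => hx) (fun x hx => by have := key' x hx; omega)

/-- A unit-step walk of length `L` with a turning point is a shorter walk precomposed with a
folding of `{0,…,L}`. -/
lemma isGenerated_of_turn {n L : ℕ} {w : ℕ → ℕ}
    (ih : ∀ M < L, ∀ u : ℕ → ℕ, (∀ i < M, u i ≤ u (i + 1) + 1 ∧ u (i + 1) ≤ u i + 1) →
      (∀ i ≤ M, u i < n) → IsGenerated n M u)
    (hw : ∀ i < L, w (i + 1) = w i + 1 ∨ w i = w (i + 1) + 1) (hL : L < n)
    (hwn : ∀ i ≤ L, w i < n)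
    {t : ℕ} (ht0 : 0 < t) (htL : t < L) (ht : w (t - 1) = w (t + 1)) : IsGenerated n L w := by
  classical
  let T : ℕ → Prop := fun a => a = 0 ∨ a = L ∨ (0 < a ∧ a < L ∧ w (a - 1) = w (a + 1))
  have hex : ∃ j, 1 ≤ j ∧ ∃ a, T a ∧ T (a + j) :=
    ⟨t, ht0, 0, Or.inl rfl, Or.inr (Or.inr (by simpa using ⟨ht0, htL, ht⟩))⟩
  obtain ⟨j, ⟨hj, a, ha, hb⟩, hmin⟩ : ∃ j, (1 ≤ j ∧ ∃ a, T a ∧ T (a + j)) ∧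
      ∀ a b, T a → T b → a < b → j ≤ b - a := by
    refine ⟨Nat.find hex, Nat.find_spec hex, fun a b ha hb hab => ?_⟩
    exact Nat.find_min' hex ⟨by omega, a, ha, by rwa [Nat.add_sub_cancel' hab.le]⟩
  have hT0 : T 0 := Or.inl rfl
  have hTL : T L := Or.inr (Or.inl rfl)
  have hTt : T t := Or.inr (Or.inr ⟨ht0, htL, ht⟩)
  have hstep : ∀ i < L, w i ≤ w (i + 1) + 1 ∧ w (i + 1) ≤ w i + 1 := fun i hi => by
    have := hw i hi
    omega
  have hsymm : ∀ s, 0 < s → s < L → w (s - 1) = w (s + 1) →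
      j ≤ s ∧ s + j ≤ L ∧ ∀ x ≤ j, w (s + x) = w (s - x) := by
    intro s hs0 hsL hs
    have hTs : T s := Or.inr (Or.inr ⟨hs0, hsL, hs⟩)
    have h1 := hmin 0 s hT0 hTs hs0
    have h2 := hmin s L hTs hTL hsL
    refine ⟨by omega, by omega, eq_reflect_of_turn hw hs (by omega) (by omega) ?_⟩
    intro r hr0 hrL hr hrs
    have hTr : T r := Or.inr (Or.inr ⟨hr0, hrL, hr⟩)
    rcases lt_or_gt_of_ne hrs with h | h
    · have := hmin r s hTr hTs h
      omega
    · have := hmin s r hTs hTr h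
      omega
  have hjL := hmin 0 t hT0 hTt ht0
  rcases ha with rfl | rfl | ⟨ha0, haL, ha⟩
  · rw [zero_add] at hb
    rcases hb with rfl | rfl | ⟨hb0, hbL, hb⟩
    · omega
    · omega
    · obtain ⟨-, h2, hs⟩ := hsymm j hb0 hbL hb
      refine (ih (L - j) (by omega) (fun x => w (j + x)) (fun i hi => hstep (j + i) (by omega))
        (fun i hi => hwn _ (by omega))).comp (isGenerated_dist (a := j) (by omega) hL)
        (fun x hx => by omega) (fun x hx => ?_)
      by_cases hxj : x ≤ j
      · rw [hs _ (by omega)]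
        congr 1
        omega
      · congr 1
        omega
  · rcases hb with h | h | ⟨-, h, -⟩ <;> omega
  · rcases hb with h | hb | ⟨hb0, hbL, hb⟩
    · omega
    · obtain ⟨h1, h2, hs⟩ := hsymm a ha0 haL ha
      refine (ih a haL w (fun i hi => hstep i (by omega)) (fun i hi => hwn _ (by omega))).comp
        ((isGenerated_dist (a := a) (L := a) (by omega) (by omega)).comp
          (isGenerated_dist (a := a) (by omega) hL) (fun x hx => by omega) (fun x hx => rfl))
        (fun x hx => by omega) (fun x hx => ?_)
      by_cases hxa : x ≤ a
      · congr 1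
        omega
      · have := hs (x - a) (by omega)
        rw [Nat.add_sub_cancel' (by omega)] at this
        rw [this]
        congr 1
        omega
    · obtain ⟨h1, h2, hs⟩ := hsymm a ha0 haL ha
      obtain ⟨h3, h4, hs'⟩ := hsymm (a + j) hb0 hbL hb
      have hret : w (a + 2 * j) = w a := by
        have := hs' j le_rfl
        rwa [Nat.add_sub_cancel, add_assoc, ← two_mul] at this
      refine (ih (L - 2 * j) (by omega) (fun x => if x ≤ a then w x else w (x + 2 * j)) ?_ ?_).comp
        (isGenerated_zigzag (p := a) hj h1 (by omega) hL)
        (fun x hx => by split_ifs <;> omega) ?_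
      · intro i hi
        rcases lt_trichotomy i a with h | rfl | h
        · have := hstep i (by omega)
          simpa [h.le, Nat.succ_le_of_lt h] using this
        · have := hstep (i + 2 * j) (by omega)
          rw [hret, add_right_comm] at this
          simpa using this
        · have := hstep (i + 2 * j) (by omega)
          rw [add_right_comm] at this
          simpa [h.not_ge, (h.trans (Nat.lt_succ_self i)).not_ge] using this
      · intro i hi
        split_ifs
        · exact hwn _ (by omega)
        · exact hwn _ (by omega)
      · intro x hx
        by_cases c1 : x ≤ a
        · simp [c1]
        by_cases c2 : x ≤ a + j
        · have := hs (x - a) (by omega)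
          rw [Nat.add_sub_cancel' (by omega)] at this
          rw [if_neg c1, if_pos c2, if_pos (by omega), this]
          congr 1
          omega
        · rw [if_neg c1, if_neg c2]
          by_cases c3 : x ≤ a + 2 * j
          · have e1 := hs' (x - (a + j)) (by omega)
            have e2 := hs (a + 2 * j - x) (by omega)
            rw [Nat.add_sub_cancel' (by omega)] at e1
            rw [if_pos (by omega), e1,
              show a + j - (x - (a + j)) = a + (a + 2 * j - x) by omega, e2]
            congr 1
            omega
          · rw [if_neg (by omega), Nat.sub_add_cancel (by omega)]

lemma isGenerated_of_weak_walk {n : ℕ} (L : ℕ) (hL : L < n) (w : ℕ → ℕ)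
    (hw : ∀ i < L, w i ≤ w (i + 1) + 1 ∧ w (i + 1) ≤ w i + 1) (hwn : ∀ i ≤ L, w i < n) :
    IsGenerated n L w := by
  induction L using Nat.strong_induction_on generalizing w with
  | _ L ih =>
    by_cases hz : ∃ i < L, w (i + 1) = w i
    · obtain ⟨i, hi, hwi⟩ := hz
      refine (ih (L - 1) (by omega) (by omega) (fun x => if x ≤ i then w x else w (x + 1))
        ?_ ?_).comp (isGenerated_merge (i := i + 1) (by omega) (by omega) hL)
        (fun x hx => by split_ifs <;> omega) ?_
      · intro k hk
        rcases lt_trichotomy k i with h | rfl | h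
        · have := hw k (by omega)
          simpa [h.le, Nat.succ_le_of_lt h] using this
        · have := hw (k + 1) (by omega)
          rw [hwi] at this
          simpa using this
        · have := hw (k + 1) (by omega)
          simpa [h.not_ge, (h.trans (Nat.lt_succ_self k)).not_ge] using this
      · intro k hk
        split_ifs
        · exact hwn _ (by omega)
        · exact hwn _ (by omega)
      · intro x hx
        rcases lt_trichotomy x (i + 1) with h | rfl | h
        · rw [if_pos h, if_pos (by omega)]
        · simp [hwi]
        · rw [if_neg (show ¬ x < i + 1 by omega), if_neg (by omega), Nat.sub_add_cancel (by omega)]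
    · have hunit : ∀ i < L, w (i + 1) = w i + 1 ∨ w i = w (i + 1) + 1 := fun i hi => by
        have h1 := hw i hi
        have h2 : w (i + 1) ≠ w i := fun h => hz ⟨i, hi, h⟩
        omega
      by_cases ht : ∃ t, 0 < t ∧ t < L ∧ w (t - 1) = w (t + 1)
      · obtain ⟨t, ht0, htL, ht⟩ := ht
        exact isGenerated_of_turn (fun M hM u hu hun => ih M hM (by omega) u hu hun)
          hunit hL hwn ht0 htL ht
      · exact isGenerated_of_no_turn hunit hL hwn fun s hs0 hsL h => ht ⟨s, hs0, hsL, h⟩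

lemma isWEndo_iff {n : ℕ} {f : Function.End (Fin n)} :
    IsWEndo f ↔ ∀ x y : Fin n, (x : ℕ) ≤ y + 1 → (y : ℕ) ≤ x + 1 →
      ((f x : Fin n) : ℕ) ≤ (f y : Fin n) + 1 := by
  constructor
  · rintro h ⟨x, hx⟩ ⟨y, hy⟩ h1 h2
    simp only at h1 h2
    obtain rfl | rfl | rfl : x = y ∨ x = y + 1 ∨ y = x + 1 := by omega
    · omega
    · have := abs_le.1 (h y hx)
      omega
    · have := abs_le.1 (h x hy)
      omega
  · intro h i hi
    have h1 := h ⟨i, by omega⟩ ⟨i + 1, hi⟩ (by simp; omega) (by simp)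
    have h2 := h ⟨i + 1, hi⟩ ⟨i, by omega⟩ (by simp) (by simp; omega)
    rw [abs_le]
    omega

lemma isWEndo_of_mem_genB {n : ℕ} {g : Function.End (Fin n)} (hg : g ∈ genB n) : IsWEndo g := by
  rw [isWEndo_iff]
  intro x y h1 h2
  rcases hg with ((rfl | ⟨i, hi, hi', rfl⟩) | ⟨j, hj, hj', i, hi, hi', rfl⟩) | ⟨i, hi, hi', rfl⟩
  · rw [pathTau_val, pathTau_val]
    omega
  · rw [pathAlpha_val (by omega), pathAlpha_val (by omega)]
    omega
  · rw [pathBeta_val, pathBeta_val]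
    split_ifs <;> omega
  · rw [pathGamma_val, pathGamma_val]
    split_ifs <;> omega

/-- The set `B` generates the monoid `wEnd P_n`. -/
theorem genB_generates_wEnd_path (n : ℕ) :
    (Submonoid.closure (genB n) : Set (Function.End (Fin n))) = {f | IsWEndo f} := by
  ext f
  constructor
  · intro hf
    refine Submonoid.closure_induction (motive := fun g _ => IsWEndo g)
      (fun g hg => isWEndo_of_mem_genB hg) (isWEndo_iff.2 fun x y h _ => h) ?_ hf
    intro a b _ _ ha hb
    rw [isWEndo_iff] at *
    exact fun x y h1 h2 => ha _ _ (hb x y h1 h2) (hb y x h2 h1)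
  · intro hf
    rcases Nat.eq_zero_or_pos n with rfl | hn
    · rw [show f = 1 from funext fun x => x.elim0]
      exact one_mem _
    · have hf' := isWEndo_iff.1 hf
      obtain ⟨h, hh, hfh⟩ := isGenerated_of_weak_walk (n := n) (n - 1) (by omega)
        (fun x => if hx : x < n then ((f ⟨x, hx⟩ : Fin n) : ℕ) else 0)
        (fun i hi => by
          rw [dif_pos (show i < n by omega), dif_pos (show i + 1 < n by omega)]
          exact ⟨hf' _ _ (by simp; omega) (by simp), hf' _ _ (by simp) (by simp; omega)⟩)
        (fun i hi => by
          rw [dif_pos (show i < n by omega)]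
          exact Fin.is_lt _)
      have : f = h := funext fun x => Fin.ext (by
        exact ((hfh x (by omega)).trans (dif_pos x.isLt)).symm)
      rw [this]
      exact hh
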